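/- Let p ≥ 5 be a prime, m = ⌊p/6⌋, d = m + 2δ, and write ss_p^{(3*)}(Y) = Σ_{k=0}^{d} a_k Y^k with a_k ∈ 𝔽_p. Then Σ_{k=0}^{d} a_k · X^{2k} · (X − 27)^{d−k} = X^δ · (X − 54)^δ · ss_p^{(3)}(X) in 𝔽_p[X]; that is, (X − 27)^{m+2δ} · ss_p^{(3*)}(X²/(X−27)) = X^δ (X − 54)^δ ss_p^{(3)}(X) mod p. -/

import Mathlib

open Polynomial

noncomputable section

/-- The class number h(√-d) of the imaginary quadratic field ℚ(√-d),
realized as the subfield of ℂ generated by i·√d. -/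
def classNumberSqrtNeg (d : ℕ) : ℕ :=
  haveI : FiniteDimensional ℚ (IntermediateField.adjoin ℚ {(Complex.I * Real.sqrt d : ℂ)}) :=
    IntermediateField.adjoin.finiteDimensional
      ⟨X ^ 2 + C (d : ℚ), monic_X_pow_add_C _ (by norm_num), by
        have h : (Complex.I * (Real.sqrt d : ℂ)) ^ 2 = -(d : ℂ) := by
          rw [mul_pow, Complex.I_sq, ← Complex.ofReal_pow, Real.sq_sqrt (Nat.cast_nonneg d)]
          simp
        simp [h]⟩
  haveI : NumberField (IntermediateField.adjoin ℚ {(Complex.I * Real.sqrt d : ℂ)}) := ⟨⟩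
  NumberField.classNumber (IntermediateField.adjoin ℚ {(Complex.I * Real.sqrt d : ℂ)})

variable (p : ℕ) [Fact p.Prime]

/-- ε = (1 - (-1|p))/2 -/
def eps : ℕ := ((1 - legendreSym p (-1)) / 2).toNat
/-- δ = (1 - (-3|p))/2 -/
def del : ℕ := ((1 - legendreSym p (-3)) / 2).toNat
/-- ν = (1 - (-2|p))/2 -/
def nu : ℕ := ((1 - legendreSym p (-2)) / 2).toNat

/-- The Pochhammer symbol (x)_n = x(x+1)⋯(x+n-1) in 𝔽_p. -/
def poch (x : ZMod p) (n : ℕ) : ZMod p := (ascPochhammer (ZMod p) n).eval x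

/-- The level-3 Fricke supersingular polynomial ss_p^{(3*)}(X) ∈ 𝔽_p[X]:
(X-108)^δ · Σ_{n=0}^{m₃} ((-m₃)_n (β₃)_n / (n!)²) 108^n X^{m₃+δ-n},
with m₃ = ⌊p/6⌋ and β₃ = 1/3 + δ/3. -/
def ss3Star : (ZMod p)[X] :=
  (X - C 108) ^ del p *
    ∑ n ∈ Finset.range (p / 6 + 1),
      C (poch p (-(p / 6 : ℕ) : ZMod p) n *
         poch p ((1 : ZMod p) / 3 + (del p : ZMod p) / 3) n /
         ((n.factorial : ZMod p)) ^ 2 * 108 ^ n) *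
      X ^ (p / 6 + del p - n)

/-- L^{(3*)}(p): the number of distinct roots of ss_p^{(3*)}(X) in 𝔽_p. -/
def L3Star : ℕ := (ss3Star p).roots.toFinset.card

/-- The level-3 supersingular polynomial ss_p^{(3)}(X) ∈ 𝔽_p[X]:
Σ_{n=0}^{m} ((-m)_n (2/3-δ/3)_n / (n!)²) 27^n X^{m+δ-n}, with m = ⌊p/3⌋. -/
def ss3Poly : (ZMod p)[X] :=
  ∑ n ∈ Finset.range (p / 3 + 1),
    C (poch p (-(p / 3 : ℕ) : ZMod p) n *
       poch p ((2 : ZMod p) / 3 - (del p : ZMod p) / 3) n /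
       ((n.factorial : ZMod p)) ^ 2 * 27 ^ n) *
    X ^ (p / 3 + del p - n)

/-- L^{(3)}(p): the number of distinct roots of ss_p^{(3)}(X) in 𝔽_p. -/
def L3 : ℕ := (ss3Poly p).roots.toFinset.card

/-- The truncation at degree `N` of the hypergeometric series `₂F₁(a, b; 1; X)`. -/
def hypergeomTrunc {K : Type*} [Field K] (N : ℕ) (a b : K) : K[X] :=
  ∑ n ∈ Finset.range (N + 1),
    C ((ascPochhammer K n).eval a * (ascPochhammer K n).eval b / (n.factorial : K) ^ 2) * X ^ n

/-- The hypergeometric differential operator with parameters `(a, b; 1)`. -/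
def hypergeomOp {K : Type*} [Field K] (a b : K) (f : K[X]) : K[X] :=
  X * (1 - X) * derivative (derivative f) + (1 - C (a + b + 1) * X) * derivative f - C (a * b) * f

theorem coeff_hypergeomOp {K : Type*} [Field K] (a b : K) (f : K[X]) (n : ℕ) :
    (hypergeomOp a b f).coeff n =
      ((n : K) + 1) ^ 2 * f.coeff (n + 1) - (n + a) * (n + b) * f.coeff n := by
  have h : hypergeomOp a b f = X * derivative (derivative f) - X * (X * derivative (derivative f))
      + derivative f - C (a + b + 1) * (X * derivative f) - C (a * b) * f := by
    rw [hypergeomOp]; ring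
  rw [h]
  simp only [coeff_sub, coeff_add, coeff_C_mul]
  rcases n with _ | _ | n
  · simp [coeff_derivative]
  · simp [coeff_X_mul, coeff_derivative]; ring
  · simp [coeff_X_mul, coeff_derivative]; ring

theorem coeff_hypergeomTrunc {K : Type*} [Field K] (N : ℕ) (a b : K) (n : ℕ) :
    (hypergeomTrunc N a b).coeff n = if n ≤ N then
      (ascPochhammer K n).eval a * (ascPochhammer K n).eval b / (n.factorial : K) ^ 2 else 0 := by
  simp [hypergeomTrunc, coeff_C_mul, coeff_X_pow]

theorem natDegree_hypergeomTrunc_le {K : Type*} [Field K] (N : ℕ) (a b : K) :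
    (hypergeomTrunc N a b).natDegree ≤ N := by
  rw [natDegree_le_iff_coeff_eq_zero]
  intro n hn
  rw [coeff_hypergeomTrunc, if_neg (by omega)]

theorem eval_zero_hypergeomTrunc {K : Type*} [Field K] (N : ℕ) (a b : K) :
    (hypergeomTrunc N a b).eval 0 = 1 := by
  rw [← coeff_zero_eq_eval_zero, coeff_hypergeomTrunc]; simp

theorem natCast_ne_zero_of_pos_of_lt {n : ℕ} (h0 : 0 < n) (h : n < p) : (n : ZMod p) ≠ 0 := by
  rw [Ne, ZMod.natCast_eq_zero_iff]
  exact Nat.not_dvd_of_pos_of_lt h0 h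

theorem hypergeomOp_hypergeomTrunc {N : ℕ} (hN : N < p) {a : ZMod p} (b : ZMod p)
    (ha : (N : ZMod p) + a = 0) : hypergeomOp a b (hypergeomTrunc N a b) = 0 := by
  ext n
  rw [coeff_hypergeomOp, coeff_hypergeomTrunc, coeff_hypergeomTrunc, coeff_zero]
  rcases lt_trichotomy n N with h | rfl | h
  · rw [if_pos (by omega), if_pos h.le, ascPochhammer_succ_eval, ascPochhammer_succ_eval,
      Nat.factorial_succ]
    have h1 : ((n : ZMod p) + 1) ≠ 0 := by
      exact_mod_cast natCast_ne_zero_of_pos_of_lt p n.succ_pos (by omega)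
    have h2 : (n.factorial : ZMod p) ≠ 0 := by
      rw [Ne, ZMod.natCast_eq_zero_iff, (Fact.out : p.Prime).dvd_factorial]; omega
    push_cast
    field_simp
    ring
  · simp [ha]
  · rw [if_neg (by omega), if_neg (by omega)]; simp

/-- A polynomial solution of degree `< p` of the hypergeometric equation over `𝔽_p` is determined
by its constant term. -/
theorem eq_of_hypergeomOp_eq_zero {a b : ZMod p} {f g : (ZMod p)[X]}
    (hf : hypergeomOp a b f = 0) (hg : hypergeomOp a b g = 0)
    (hfd : f.natDegree < p) (hgd : g.natDegree < p) (h0 : f.eval 0 = g.eval 0) : f = g := by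
  ext n
  induction n with
  | zero => rw [coeff_zero_eq_eval_zero, coeff_zero_eq_eval_zero, h0]
  | succ n ih =>
    by_cases hn : n + 1 < p
    · have h1 : ((n : ZMod p) + 1) ≠ 0 := by
        exact_mod_cast natCast_ne_zero_of_pos_of_lt p n.succ_pos hn
      have ef := coeff_hypergeomOp a b f n
      have eg := coeff_hypergeomOp a b g n
      rw [hf, coeff_zero] at ef
      rw [hg, coeff_zero] at eg
      apply mul_left_cancel₀ (pow_ne_zero 2 h1)
      rw [ih] at ef
      linear_combination eg - ef
    · rw [coeff_eq_zero_of_natDegree_lt (by omega), coeff_eq_zero_of_natDegree_lt (by omega)]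

theorem hypergeomOp_comp_quadratic {K : Type*} [Field K] (h2 : (2 : K) ≠ 0) (h3 : (3 : K) ≠ 0)
    {F : K[X]} (hF : hypergeomOp (1 / 6) (1 / 3) F = 0) :
    hypergeomOp (1 / 3) (2 / 3) (F.comp (4 * X * (1 - X))) = 0 := by
  have h6 : (6 : K) ≠ 0 := by
    rw [show (6 : K) = 2 * 3 by norm_num]; exact mul_ne_zero h2 h3
  have e := congrArg (fun f : K[X] => f.comp (4 * X * (1 - X))) hF
  simp only [hypergeomOp, sub_comp, add_comp, mul_comp, one_comp, X_comp, C_comp, zero_comp] at e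
  have c1 : C ((1 / 3 : K) + 2 / 3 + 1) = 2 := by
    rw [← C_ofNat]; congr 1; field_simp; norm_num
  have c2 : C ((1 / 3 : K) * (2 / 3)) = 4 * C ((1 / 6 : K) * (1 / 3)) := by
    rw [← C_ofNat, ← C_mul]; congr 1; field_simp; norm_num
  have c3 : 2 * C ((1 / 6 : K) + 1 / 3 + 1) = 3 := by
    rw [← C_ofNat, ← C_ofNat, ← C_mul]; congr 1; field_simp; norm_num
  simp only [hypergeomOp, derivative_comp, derivative_mul, derivative_sub, derivative_add,
    derivative_one, derivative_zero, derivative_X, derivative_ofNat, c1, c2]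
  linear_combination 4 * e + 8 * X * (1 - X) * ((derivative F).comp (4 * X * (1 - X))) * c3

theorem hypergeomOp_mul_comp_quadratic {K : Type*} [Field K] (h2 : (2 : K) ≠ 0) (h3 : (3 : K) ≠ 0)
    {F : K[X]} (hF : hypergeomOp (5 / 6) (2 / 3) F = 0) :
    hypergeomOp (2 / 3) (1 / 3) ((1 - 2 * X) * F.comp (4 * X * (1 - X))) = 0 := by
  have h6 : (6 : K) ≠ 0 := by
    rw [show (6 : K) = 2 * 3 by norm_num]; exact mul_ne_zero h2 h3
  have e := congrArg (fun f : K[X] => f.comp (4 * X * (1 - X))) hF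
  simp only [hypergeomOp, sub_comp, add_comp, mul_comp, one_comp, X_comp, C_comp, zero_comp] at e
  have c1 : C ((2 / 3 : K) + 1 / 3 + 1) = 2 := by
    rw [← C_ofNat]; congr 1; field_simp; norm_num
  have c2 : C ((2 / 3 : K) * (1 / 3)) = 4 * C ((5 / 6 : K) * (2 / 3)) - 2 := by
    rw [← C_ofNat, ← C_ofNat, ← C_mul, ← C_sub]; congr 1; field_simp; norm_num
  have c3 : 2 * C ((5 / 6 : K) + 2 / 3 + 1) = 5 := by
    rw [← C_ofNat, ← C_ofNat, ← C_mul]; congr 1; field_simp; norm_num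
  simp only [hypergeomOp, derivative_comp, derivative_mul, derivative_sub, derivative_add,
    derivative_one, derivative_zero, derivative_X, derivative_ofNat, c1, c2]
  linear_combination 4 * (1 - 2 * X) * e +
    8 * X * (1 - X) * (1 - 2 * X) * ((derivative F).comp (4 * X * (1 - X))) * c3

theorem natDegree_comp_quadratic_le {K : Type*} [Field K] (N : ℕ) (a b : K) :
    ((hypergeomTrunc N a b).comp (4 * X * (1 - X))).natDegree ≤ 2 * N := by
  have h : (4 * X * (1 - X) : K[X]).natDegree ≤ 2 := by compute_degree
  calc _ ≤ _ := natDegree_comp_le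
    _ ≤ N * 2 := Nat.mul_le_mul (natDegree_hypergeomTrunc_le N a b) h
    _ = 2 * N := by ring

theorem mod_six_eq (hp : 5 ≤ p) : p % 6 = 1 ∨ p % 6 = 5 := by
  have hpr : p.Prime := Fact.out
  have a2 : ¬ 2 ∣ p := fun h => by
    have := (Nat.prime_dvd_prime_iff_eq Nat.prime_two hpr).1 h; omega
  have a3 : ¬ 3 ∣ p := fun h => by
    have := (Nat.prime_dvd_prime_iff_eq Nat.prime_three hpr).1 h; omega
  omega

theorem del_eq_zero (h : p % 6 = 1) : del p = 0 := by
  have hodd : Odd p := by rw [Nat.odd_iff]; omega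
  have : p % 12 = 1 ∨ p % 12 = 7 := by omega
  have hJ : legendreSym p (-3) = 1 := by
    rw [jacobiSym.legendreSym.to_jacobiSym, jacobiSym.mod_right _ hodd]
    rcases this with h | h <;> norm_num [h]
  simp [del, hJ]

theorem del_eq_one (h : p % 6 = 5) : del p = 1 := by
  have hodd : Odd p := by rw [Nat.odd_iff]; omega
  have : p % 12 = 5 ∨ p % 12 = 11 := by omega
  have hJ : legendreSym p (-3) = -1 := by
    rw [jacobiSym.legendreSym.to_jacobiSym, jacobiSym.mod_right _ hodd]
    rcases this with h | h <;> norm_num [h]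
  simp [del, hJ]

/-- Homogenizing a polynomial of degree at most `N`. -/
theorem sum_coeff_mul_pow_mul_pow {K L : Type*} [Field K] [Field L] [Algebra K L] {N : ℕ} {f : K[X]}
    (hf : f.natDegree ≤ N) (u : L) {v : L} (hv : v ≠ 0) :
    ∑ k ∈ Finset.range (N + 1), algebraMap K L (f.coeff k) * u ^ k * v ^ (N - k) =
      v ^ N * aeval (u / v) f := by
  rw [aeval_eq_sum_range' (Nat.lt_succ_of_le hf), Finset.mul_sum]
  refine Finset.sum_congr rfl fun k hk => ?_
  rw [Finset.mem_range] at hk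
  rw [Algebra.smul_def, ← Nat.sub_add_cancel (Nat.le_of_lt_succ hk), Nat.add_sub_cancel, pow_add,
    div_pow]
  field_simp

/-- The reversed, rescaled hypergeometric sum evaluated away from zero. -/
theorem aeval_sum_hypergeom {K L : Type*} [Field K] [Field L] [Algebra K L] (N e : ℕ) (a b c : K)
    {y : L} (hy : y ≠ 0) :
    aeval y (∑ n ∈ Finset.range (N + 1),
      C ((ascPochhammer K n).eval a * (ascPochhammer K n).eval b / (n.factorial : K) ^ 2 * c ^ n) *
        X ^ (N + e - n)) = y ^ (N + e) * aeval (algebraMap K L c / y) (hypergeomTrunc N a b) := by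
  rw [hypergeomTrunc, map_sum, map_sum, Finset.mul_sum]
  refine Finset.sum_congr rfl fun n hn => ?_
  rw [Finset.mem_range] at hn
  obtain ⟨k, hk⟩ : ∃ k, N + e = k + n := ⟨N + e - n, by omega⟩
  rw [hk, Nat.add_sub_cancel]
  simp only [map_mul, aeval_C, map_pow, aeval_X, div_pow, pow_add]
  field_simp

theorem aeval_ss3Star {L : Type*} [Field L] [Algebra (ZMod p) L] {y : L} (hy : y ≠ 0) :
    aeval y (ss3Star p) = (y - 108) ^ del p * (y ^ (p / 6 + del p) *
      aeval (108 / y) (hypergeomTrunc (p / 6) (-(p / 6 : ℕ) : ZMod p)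
        ((1 : ZMod p) / 3 + (del p : ZMod p) / 3))) := by
  have := aeval_sum_hypergeom (p / 6) (del p) (-(p / 6 : ℕ) : ZMod p)
    ((1 : ZMod p) / 3 + (del p : ZMod p) / 3) 108 hy
  rw [map_ofNat] at this
  simp only [ss3Star, poch, map_mul, map_pow, map_sub, aeval_X, map_ofNat, ← this]

theorem aeval_ss3Poly {L : Type*} [Field L] [Algebra (ZMod p) L] {y : L} (hy : y ≠ 0) :
    aeval y (ss3Poly p) = y ^ (p / 3 + del p) *
      aeval (27 / y) (hypergeomTrunc (p / 3) (-(p / 3 : ℕ) : ZMod p)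
        ((2 : ZMod p) / 3 - (del p : ZMod p) / 3)) := by
  have := aeval_sum_hypergeom (p / 3) (del p) (-(p / 3 : ℕ) : ZMod p)
    ((2 : ZMod p) / 3 - (del p : ZMod p) / 3) 27 hy
  rw [map_ofNat] at this
  simp only [ss3Poly, poch, ← this]

theorem natDegree_ss3Star_le : (ss3Star p).natDegree ≤ p / 6 + 2 * del p := by
  have h1 : ((X - C 108 : (ZMod p)[X]) ^ del p).natDegree ≤ del p :=
    (natDegree_pow_le_of_le (del p) (natDegree_X_sub_C_le 108)).trans (by simp)
  refine (natDegree_mul_le_of_le h1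
    (natDegree_sum_le_of_forall_le _ _ (n := p / 6 + del p) fun n _ => ?_)).trans (by omega)
  exact (natDegree_C_mul_X_pow_le _ _).trans (Nat.sub_le _ _)

/-- The quadratic transformation relating the two truncated hypergeometric series. -/
theorem hypergeomTrunc_comp_quadratic (hp : 5 ≤ p) :
    (1 - 2 * X) ^ del p * (hypergeomTrunc (p / 6) (-(p / 6 : ℕ) : ZMod p)
        ((1 : ZMod p) / 3 + (del p : ZMod p) / 3)).comp (4 * X * (1 - X)) =
      hypergeomTrunc (p / 3) (-(p / 3 : ℕ) : ZMod p)
        ((2 : ZMod p) / 3 - (del p : ZMod p) / 3) := by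
  have h2 : (2 : ZMod p) ≠ 0 := by
    exact_mod_cast natCast_ne_zero_of_pos_of_lt p (n := 2) (by omega) (by omega)
  have h3 : (3 : ZMod p) ≠ 0 := by
    exact_mod_cast natCast_ne_zero_of_pos_of_lt p (n := 3) (by omega) (by omega)
  have h6 : (6 : ZMod p) ≠ 0 := by
    rw [show (6 : ZMod p) = 2 * 3 by norm_num]; exact mul_ne_zero h2 h3
  have hpz : ((p : ℕ) : ZMod p) = 0 := ZMod.natCast_self p
  have hm := natDegree_comp_quadratic_le (p / 6) (-(p / 6 : ℕ) : ZMod p)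
        ((1 : ZMod p) / 3 + (del p : ZMod p) / 3)
  have hn := natDegree_hypergeomTrunc_le (p / 3) (-(p / 3 : ℕ) : ZMod p)
        ((2 : ZMod p) / 3 - (del p : ZMod p) / 3)
  have hlt6 : p / 6 < p := by omega
  have hlt3 : p / 3 < p := by omega
  have hode6 := hypergeomOp_hypergeomTrunc p hlt6 ((1 : ZMod p) / 3 + (del p : ZMod p) / 3)
    (add_neg_cancel _)
  have hode3 := hypergeomOp_hypergeomTrunc p hlt3 ((2 : ZMod p) / 3 - (del p : ZMod p) / 3)
    (add_neg_cancel _)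
  rcases mod_six_eq p hp with h | h
  · have e6 : -((p / 6 : ℕ) : ZMod p) = 1 / 6 := by
      have hdiv : 6 * (p / 6) + 1 = p := by omega
      have := congrArg (Nat.cast : ℕ → ZMod p) hdiv
      rw [hpz] at this
      push_cast at this
      rw [eq_div_iff h6]
      linear_combination -this
    have e3 : -((p / 3 : ℕ) : ZMod p) = 1 / 3 := by
      have hdiv : 3 * (p / 3) + 1 = p := by omega
      have := congrArg (Nat.cast : ℕ → ZMod p) hdiv
      rw [hpz] at this
      push_cast at this
      rw [eq_div_iff h3]
      linear_combination -this
    rw [del_eq_zero p h, e6] at hm hode6 ⊢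
    rw [del_eq_zero p h, e3] at hn hode3
    rw [e3]
    simp only [Nat.cast_zero, zero_div, add_zero, sub_zero, pow_zero, one_mul] at hm hn hode6 hode3 ⊢
    refine eq_of_hypergeomOp_eq_zero p (hypergeomOp_comp_quadratic h2 h3 hode6) hode3
      (by omega) (by omega) ?_
    simp [eval_comp, eval_zero_hypergeomTrunc]
  · have e6 : -((p / 6 : ℕ) : ZMod p) = 5 / 6 := by
      have hdiv : 6 * (p / 6) + 5 = p := by omega
      have := congrArg (Nat.cast : ℕ → ZMod p) hdiv
      rw [hpz] at this
      push_cast at this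
      rw [eq_div_iff h6]
      linear_combination -this
    have e3 : -((p / 3 : ℕ) : ZMod p) = 2 / 3 := by
      have hdiv : 3 * (p / 3) + 2 = p := by omega
      have := congrArg (Nat.cast : ℕ → ZMod p) hdiv
      rw [hpz] at this
      push_cast at this
      rw [eq_div_iff h3]
      linear_combination -this
    have b6 : (1 : ZMod p) / 3 + 1 / 3 = 2 / 3 := by ring
    have b3 : (2 : ZMod p) / 3 - 1 / 3 = 1 / 3 := by ring
    rw [del_eq_one p h, e6] at hm hode6 ⊢
    rw [del_eq_one p h, e3] at hn hode3
    rw [e3]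
    simp only [Nat.cast_one, b6, b3, pow_one] at hm hn hode6 hode3 ⊢
    refine eq_of_hypergeomOp_eq_zero p (hypergeomOp_mul_comp_quadratic h2 h3 hode6) hode3
      ?_ (by omega) ?_
    · have h1 : (1 - 2 * X : (ZMod p)[X]).natDegree ≤ 1 := by compute_degree
      have := natDegree_mul_le_of_le h1 hm
      omega
    · simp [eval_comp, eval_zero_hypergeomTrunc]

theorem div_three_eq (hp : 5 ≤ p) : p / 3 = 2 * (p / 6) + del p := by
  rcases mod_six_eq p hp with h | h
  · rw [del_eq_zero p h]; omega
  · rw [del_eq_one p h]; omega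

theorem sum_coeff_ss3Star_eq (hp : 5 ≤ p) {L : Type*} [Field L] [Algebra (ZMod p) L] {t : L}
    (ht0 : t ≠ 0) (hw0 : t - 27 ≠ 0) :
    ∑ k ∈ Finset.range ((p / 6 + 2 * del p) + 1), algebraMap (ZMod p) L ((ss3Star p).coeff k) *
        (t ^ 2) ^ k * (t - 27) ^ ((p / 6 + 2 * del p) - k) =
      t ^ del p * (t - 54) ^ del p * aeval t (ss3Poly p) := by
  have hq := congrArg (aeval (27 / t : L)) (hypergeomTrunc_comp_quadratic p hp)
  have harg : aeval (27 / t : L) (4 * X * (1 - X) : (ZMod p)[X]) = 108 / (t ^ 2 / (t - 27)) := by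
    simp only [map_mul, map_sub, map_one, aeval_X, map_ofNat]
    field_simp
    ring
  have hlin : aeval (27 / t : L) (1 - 2 * X : (ZMod p)[X]) = (t - 54) / t := by
    simp only [map_mul, map_sub, map_one, aeval_X, map_ofNat]
    field_simp
    ring
  have hY : t ^ 2 / (t - 27) - 108 = (t - 54) ^ 2 / (t - 27) := by
    field_simp
    ring
  rw [map_mul, map_pow, aeval_comp, harg, hlin] at hq
  rw [sum_coeff_mul_pow_mul_pow (natDegree_ss3Star_le p) (t ^ 2) hw0,
    aeval_ss3Star p (div_ne_zero (pow_ne_zero 2 ht0) hw0), aeval_ss3Poly p ht0, ← hq,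
    div_three_eq p hp, hY]
  generalize aeval (108 / (t ^ 2 / (t - 27))) (hypergeomTrunc (p / 6) (-(p / 6 : ℕ) : ZMod p)
    ((1 : ZMod p) / 3 + (del p : ZMod p) / 3)) = A
  generalize t - 54 = s
  generalize t - 27 = w at hw0 ⊢
  generalize del p = e
  generalize p / 6 = m
  simp only [div_pow]
  field_simp
  ring

/-- Let p ≥ 5 be prime, m = ⌊p/6⌋, d = m + 2δ, and a_k the coefficients of
ss_p^{(3*)}. Then Σ_{k=0}^{d} a_k X^{2k} (X − 27)^{d−k} = X^δ (X − 54)^δ ss_p^{(3)}(X)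
in 𝔽_p[X]; i.e. (X−27)^{m+2δ} ss_p^{(3*)}(X²/(X−27)) = X^δ (X−54)^δ ss_p^{(3)}(X) mod p. -/
theorem ss3star_ss3_algebraic_relation (hp : 5 ≤ p) :
    ∑ k ∈ Finset.range ((p / 6 + 2 * del p) + 1),
        C ((ss3Star p).coeff k) * X ^ (2 * k) * (X - C 27) ^ ((p / 6 + 2 * del p) - k) =
      X ^ del p * (X - C 54) ^ del p * ss3Poly p := by
  apply IsFractionRing.injective (ZMod p)[X] (FractionRing (ZMod p)[X])
  set L := FractionRing (ZMod p)[X]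
  set φ : (ZMod p)[X] →ₐ[ZMod p] L := Algebra.algHom (ZMod p) (ZMod p)[X] L
  change φ _ = φ _
  have hinj : Function.Injective φ := IsFractionRing.injective (ZMod p)[X] L
  have hφ (f : (ZMod p)[X]) : φ f = aeval (φ X) f := by
    rw [aeval_algHom_apply, aeval_X_left_apply]
  have hC (c : ZMod p) : φ (C c) = algebraMap (ZMod p) L c := by rw [hφ, aeval_C]
  have ht0 : φ X ≠ 0 := by
    rw [Ne, map_eq_zero_iff φ hinj]; exact X_ne_zero
  have hw0 : φ X - 27 ≠ 0 := by
    have h27 : φ X - 27 = φ (X - C 27) := by rw [map_sub, hC, map_ofNat]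
    rw [h27, Ne, map_eq_zero_iff φ hinj]
    exact X_sub_C_ne_zero 27
  simpa only [map_sum, map_mul, map_pow, map_sub, hC, map_ofNat, pow_mul, ← hφ] using
    sum_coeff_ss3Star_eq p hp ht0 hw0
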